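/- arXiv:2104.05420 — 2 statements merged into one kernel-verified Lean document; each statement's English description precedes it below -/
import Mathlib

section
/- Let N ≥ 1, q = 2^N, and let π be a permutation of {0,…,q−1}. Then 0 ∈ I_np, the rotated odometer F_π maps I_np into I_np, the restriction of F_π to I_np is injective, and every point of I_np except 0 has a preimage in I_np (that is, I_np ∖ {0} ⊆ F_π(I_np), while 0 has no preimage under F_π). -/
open MeasureTheory Set Function
open scoped ENNReal

noncomputable section

/-- `A` is the von Neumann–Kakutani map on `[0,1)`:
`A x = x - (1 - 3·2⁻ⁿ)` for `x ∈ [1 - 2^(1-n), 1 - 2^(-n))`, `n ≥ 1`. -/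
def IsVNK (A : ℝ → ℝ) : Prop :=
  ∀ n : ℕ, 1 ≤ n →
    ∀ x ∈ Set.Ico (1 - (2:ℝ) ^ (1 - (n:ℤ))) (1 - (2:ℝ) ^ (-(n:ℤ))),
      A x = x - (1 - 3 * (2:ℝ) ^ (-(n:ℤ)))

/-- `R` is the interval exchange of the `q` intervals of length `1/q` determined by the
permutation `π`: `R x = x + (π p - p)/q` for `x ∈ [p/q, (p+1)/q)`. -/
def IsIET (q : ℕ) (π : Equiv.Perm (Fin q)) (R : ℝ → ℝ) : Prop :=
  ∀ p : Fin q,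
    ∀ x ∈ Set.Ico (((p : ℕ) : ℝ) / (q : ℝ)) ((((p : ℕ) : ℝ) + 1) / (q : ℝ)),
      R x = x + (((π p : ℕ) : ℝ) - ((p : ℕ) : ℝ)) / (q : ℝ)

/-- The set of periodic points of `F` in `[0,1)`. -/
def Iper (F : ℝ → ℝ) : Set ℝ :=
  {x ∈ Set.Ico (0:ℝ) 1 | ∃ k, 1 ≤ k ∧ F^[k] x = x}

/-- The set of non-periodic points of `F` in `[0,1)`. -/
def Inp (F : ℝ → ℝ) : Set ℝ := Set.Ico (0:ℝ) 1 \ Iper F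

namespace IsVNK

lemma apply_mem {A : ℝ → ℝ} (hA : IsVNK A) {n : ℕ} (hn : 1 ≤ n) {x : ℝ}
    (hx : x ∈ Ico (1 - (2:ℝ) ^ (1 - (n:ℤ))) (1 - (2:ℝ) ^ (-(n:ℤ)))) :
    A x ∈ Ico ((2:ℝ) ^ (-(n:ℤ))) ((2:ℝ) ^ (-(n:ℤ) + 1)) := by
  rw [hA n hn x hx]
  have h1 : (2:ℝ) ^ (1 - (n:ℤ)) = 2 * 2 ^ (-(n:ℤ)) := by
    rw [sub_eq_add_neg, zpow_add₀ two_ne_zero, zpow_one]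
  have h2 : (2:ℝ) ^ (-(n:ℤ) + 1) = 2 * 2 ^ (-(n:ℤ)) := by
    rw [zpow_add₀ two_ne_zero, zpow_one, mul_comm]
  rw [h1] at hx
  rw [h2]
  constructor <;> linarith [hx.1, hx.2]

lemma exists_mem_dyadic {x : ℝ} (hx : x ∈ Ico (0:ℝ) 1) :
    ∃ n : ℕ, 1 ≤ n ∧ x ∈ Ico (1 - (2:ℝ) ^ (1 - (n:ℤ))) (1 - (2:ℝ) ^ (-(n:ℤ))) := by
  obtain ⟨k, hk1, hk2⟩ := exists_mem_Ioc_zpow (x := 1 - x) (y := (2:ℝ)) (by linarith [hx.2])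
    one_lt_two
  have hk : k < 0 := (zpow_lt_one_iff_right₀ (one_lt_two (α := ℝ))).1 (by linarith [hx.1])
  obtain ⟨n, rfl⟩ : ∃ n : ℕ, k = -(n:ℤ) := ⟨k.natAbs, by omega⟩
  rw [neg_add_eq_sub] at hk2
  exact ⟨n, by omega, by linarith, by linarith⟩

lemma mapsTo {A : ℝ → ℝ} (hA : IsVNK A) : MapsTo A (Ico 0 1) (Ioo 0 1) := by
  intro x hx
  obtain ⟨n, hn, hxn⟩ := exists_mem_dyadic hx
  have h := hA.apply_mem hn hxn
  refine ⟨lt_of_lt_of_le (by positivity) h.1, h.2.trans_le ?_⟩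
  exact zpow_le_one_of_nonpos₀ one_le_two (by omega)

lemma injOn {A : ℝ → ℝ} (hA : IsVNK A) : InjOn A (Ico 0 1) := by
  intro x hx y hy h
  obtain ⟨n, hn, hxn⟩ := exists_mem_dyadic hx
  obtain ⟨m, hm, hym⟩ := exists_mem_dyadic hy
  have h1 := hA.apply_mem hn hxn
  have h2 := hA.apply_mem hm hym
  rw [h] at h1
  have h3 := (zpow_lt_zpow_iff_right₀ (one_lt_two (α := ℝ))).1 (h1.1.trans_lt h2.2)
  have h4 := (zpow_lt_zpow_iff_right₀ (one_lt_two (α := ℝ))).1 (h2.1.trans_lt h1.2)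
  obtain rfl : n = m := by omega
  rw [hA n hn x hxn, hA n hn y hym] at h
  linarith

lemma surjOn {A : ℝ → ℝ} (hA : IsVNK A) : SurjOn A (Ico 0 1) (Ioo 0 1) := by
  intro y hy
  obtain ⟨k, hk1, hk2⟩ := exists_mem_Ico_zpow hy.1 (one_lt_two (α := ℝ))
  have hk : k < 0 := (zpow_lt_one_iff_right₀ (one_lt_two (α := ℝ))).1 (hk1.trans_lt hy.2)
  obtain ⟨n, rfl⟩ : ∃ n : ℕ, k = -(n:ℤ) := ⟨k.natAbs, by omega⟩
  have h1 : (2:ℝ) ^ (1 - (n:ℤ)) = 2 * 2 ^ (-(n:ℤ)) := by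
    rw [sub_eq_add_neg, zpow_add₀ two_ne_zero, zpow_one]
  have h2 : (2:ℝ) ^ (1 - (n:ℤ)) ≤ 1 := zpow_le_one_of_nonpos₀ one_le_two (by omega)
  have h3 : (0:ℝ) < 2 ^ (-(n:ℤ)) := by positivity
  rw [neg_add_eq_sub] at hk2
  have hx : y + (1 - 3 * (2:ℝ) ^ (-(n:ℤ))) ∈
      Ico (1 - (2:ℝ) ^ (1 - (n:ℤ))) (1 - (2:ℝ) ^ (-(n:ℤ))) := by
    constructor <;> linarith
  refine ⟨y + (1 - 3 * (2:ℝ) ^ (-(n:ℤ))), ⟨by linarith, by linarith⟩, ?_⟩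
  rw [hA n (by omega) _ hx]
  ring

lemma bijOn {A : ℝ → ℝ} (hA : IsVNK A) : BijOn A (Ico 0 1) (Ioo 0 1) :=
  ⟨hA.mapsTo, hA.injOn, hA.surjOn⟩

end IsVNK

namespace IsIET

variable {q : ℕ} {π : Equiv.Perm (Fin q)} {R : ℝ → ℝ}

lemma apply_mem (hR : IsIET q π R) (p : Fin q) {x : ℝ}
    (hx : x ∈ Ico (((p : ℕ) : ℝ) / q) ((((p : ℕ) : ℝ) + 1) / q)) :
    R x ∈ Ico (((π p : ℕ) : ℝ) / q) ((((π p : ℕ) : ℝ) + 1) / q) := by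
  rw [hR p x hx]
  obtain ⟨h1, h2⟩ := hx
  rw [add_div] at h2
  rw [sub_div, add_div]
  constructor <;> linarith

lemma Ico_subset_unit (p : Fin q) :
    Ico (((p : ℕ) : ℝ) / q) ((((p : ℕ) : ℝ) + 1) / q) ⊆ Ico 0 1 := by
  refine Ico_subset_Ico (by positivity) (div_le_one_of_le₀ ?_ (by positivity))
  exact_mod_cast p.2

lemma exists_mem_Ico (hq : 0 < q) {x : ℝ} (hx : x ∈ Ico (0:ℝ) 1) :
    ∃ p : Fin q, x ∈ Ico (((p : ℕ) : ℝ) / q) ((((p : ℕ) : ℝ) + 1) / q) := by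
  have hq' : (0:ℝ) < q := by exact_mod_cast hq
  have h0 : 0 ≤ x * q := mul_nonneg hx.1 hq'.le
  refine ⟨⟨⌊x * q⌋₊, (Nat.floor_lt h0).2 (by nlinarith [hx.2])⟩, ?_, ?_⟩
  · exact (div_le_iff₀ hq').2 (Nat.floor_le h0)
  · exact (lt_div_iff₀ hq').2 (Nat.lt_floor_add_one _)

lemma eq_of_mem_Ico {p r : Fin q} {x : ℝ}
    (hp : x ∈ Ico (((p : ℕ) : ℝ) / q) ((((p : ℕ) : ℝ) + 1) / q))
    (hr : x ∈ Ico (((r : ℕ) : ℝ) / q) ((((r : ℕ) : ℝ) + 1) / q)) : p = r := by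
  have hq : (0:ℝ) < q := by exact_mod_cast p.pos
  have h1 := (div_lt_div_iff_of_pos_right hq).1 (hp.1.trans_lt hr.2)
  have h2 := (div_lt_div_iff_of_pos_right hq).1 (hr.1.trans_lt hp.2)
  norm_cast at h1 h2
  omega

lemma bijOn (hR : IsIET q π R) (hq : 0 < q) : BijOn R (Ico 0 1) (Ico 0 1) := by
  refine ⟨fun x hx ↦ ?_, fun x hx y hy h ↦ ?_, fun y hy ↦ ?_⟩
  · obtain ⟨p, hp⟩ := exists_mem_Ico hq hx
    exact Ico_subset_unit _ (hR.apply_mem p hp)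
  · obtain ⟨p, hp⟩ := exists_mem_Ico hq hx
    obtain ⟨r, hr⟩ := exists_mem_Ico hq hy
    obtain rfl : p = r := π.injective
      (eq_of_mem_Ico (hR.apply_mem p hp) (h ▸ hR.apply_mem r hr))
    rw [hR p x hp, hR p y hr] at h
    linarith
  · obtain ⟨p, hp⟩ := exists_mem_Ico hq hy
    obtain ⟨r, rfl⟩ := π.surjective p
    have hx : y - (((π r : ℕ) : ℝ) - ((r : ℕ) : ℝ)) / q ∈
        Ico (((r : ℕ) : ℝ) / q) ((((r : ℕ) : ℝ) + 1) / q) := by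
      obtain ⟨h1, h2⟩ := hp
      rw [add_div] at h2
      rw [sub_div, add_div]
      constructor <;> linarith
    exact ⟨_, Ico_subset_unit r hx, by rw [hR r _ hx]; ring⟩

end IsIET

/-- for `q = 2^N`, `0` is a non-periodic point of the rotated odometer
`F_π = ā ∘ R_π`, `F_π` maps `I_np` into itself injectively, every point of
`I_np \ {0}` has a preimage in `I_np`, and `0` has no preimage in `[0,1)`. -/
theorem stmt3 (N : ℕ) (hN : 1 ≤ N) (π : Equiv.Perm (Fin (2^N)))
    (A R F : ℝ → ℝ) (hA : IsVNK A) (hR : IsIET (2^N) π R) (hF : ∀ x, F x = A (R x)) :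
    (0:ℝ) ∈ Inp F ∧
    Set.MapsTo F (Inp F) (Inp F) ∧
    Set.InjOn F (Inp F) ∧
    Inp F \ {0} ⊆ F '' Inp F ∧
    ∀ x ∈ Set.Ico (0:ℝ) 1, F x ≠ 0 := by
  have hFeq : F = A ∘ R := funext hF
  have hb : BijOn F (Ico 0 1) (Ioo 0 1) := hFeq ▸ hA.bijOn.comp (hR.bijOn (by positivity))
  have hmaps : MapsTo F (Ico 0 1) (Ico 0 1) := hb.mapsTo.mono_right Ioo_subset_Ico_self
  have hne : ∀ x ∈ Ico (0:ℝ) 1, F x ≠ 0 := fun x hx ↦ (hb.mapsTo hx).1.ne'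
  refine ⟨⟨by simp, ?_⟩, fun x hx ↦ ⟨hmaps hx.1, ?_⟩, hb.injOn.mono sdiff_subset, ?_, hne⟩
  · rintro ⟨h0, k, hk, hkx⟩
    obtain ⟨m, rfl⟩ := Nat.exists_eq_add_of_le' hk
    rw [iterate_succ_apply'] at hkx
    exact hne _ (hmaps.iterate m h0) hkx
  · rintro ⟨-, k, hk, hkx⟩
    rw [← iterate_succ_apply, iterate_succ_apply'] at hkx
    exact hx.2 ⟨hx.1, k, hk, hb.injOn (hmaps.iterate k hx.1) hx.1 hkx⟩
  · rintro x ⟨⟨hx, hxp⟩, hx0⟩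
    obtain ⟨y, hy, rfl⟩ := hb.surjOn ⟨hx.1.lt_of_ne' hx0, hx.2⟩
    refine ⟨y, ⟨hy, fun ⟨_, k, hk, hky⟩ ↦ hxp ⟨hx, k, hk, ?_⟩⟩, rfl⟩
    rw [← iterate_succ_apply, iterate_succ_apply', hky]
end
end

section
/- Let g be a prefix-preserving homeomorphism of {0,1}^ℕ and suppose there exists m ≥ 1 such that g(w)_i = w_i for every w ∈ {0,1}^ℕ and every i > m. Then there exists a permutation π of {0,…,2^m−1} such that, with F_π the rotated odometer with q = 2^m, the binary digit map φ satisfies φ ∘ F_π = (a ∘ g) ∘ φ on [0,1); in particular, φ is an injective measure-preserving map (Lebesgue measure to μ₁) intertwining F_π with a ∘ g. -/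
open MeasureTheory Set Function
open scoped ENNReal

noncomputable section

/-- The dyadic adding machine on `{0,1}^ℕ`: addition of 1 with carry to the right
(coordinate `n` is flipped iff all earlier coordinates equal `1`). -/
def addingMachine (w : ℕ → Bool) : ℕ → Bool :=
  fun n => if ∀ i < n, w i = true then !(w n) else w n

/-- The binary digit map `φ : [0,1) → {0,1}^ℕ`, `φ(x)_i = ⌊2^i x⌋ mod 2` (the paper's
coordinate `i ≥ 1` is our coordinate `i - 1 ≥ 0`). -/
def binExp (x : ℝ) : ℕ → Bool := fun i => decide (⌊(2:ℝ) ^ (i + 1) * x⌋ % 2 = 1)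

/-- The Bernoulli (1/2,1/2) product measure on `{0,1}^ℕ`, characterized on cylinders. -/
def IsBernoulli (μ : Measure (ℕ → Bool)) : Prop :=
  ∀ (n : ℕ) (u : Fin n → Bool),
    μ {w | ∀ i : Fin n, w (i : ℕ) = u i} = ((2:ℝ≥0∞)⁻¹) ^ n

/-- `f` is prefix-preserving (induced by an automorphism of the rooted binary tree):
if `v, w` agree in their first `n` coordinates, then so do `f v, f w`. -/
def PrefixPreserving (f : (ℕ → Bool) → (ℕ → Bool)) : Prop :=
  ∀ (n : ℕ) (v w : ℕ → Bool), (∀ i < n, v i = w i) → ∀ i < n, f v i = f w i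

/-- The integer whose binary digits, most significant first, are `w 0, …, w (n - 1)`. -/
def prefixValue (w : ℕ → Bool) : ℕ → ℕ
  | 0 => 0
  | n + 1 => 2 * prefixValue w n + (w n).toNat

theorem prefixValue_lt (w : ℕ → Bool) (n : ℕ) : prefixValue w n < 2 ^ n := by
  induction n with
  | zero => simp [prefixValue]
  | succ n ih =>
    have := Bool.toNat_le (w n)
    simp only [prefixValue, pow_succ]
    omega

theorem prefixValue_congr {v w : ℕ → Bool} {n : ℕ} (h : ∀ i < n, v i = w i) :
    prefixValue v n = prefixValue w n := by
  induction n with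
  | zero => rfl
  | succ n ih =>
    simp only [prefixValue]
    rw [ih fun i hi => h i (by omega), h n (by omega)]

theorem eq_of_prefixValue_eq {v w : ℕ → Bool} {n : ℕ}
    (h : prefixValue v n = prefixValue w n) : ∀ i < n, v i = w i := by
  induction n with
  | zero => simp
  | succ n ih =>
    simp only [prefixValue] at h
    have hv := Bool.toNat_le (v n)
    have hw := Bool.toNat_le (w n)
    intro i hi
    rcases Nat.lt_succ_iff_lt_or_eq.mp hi with hi | rfl
    · exact ih (by omega) i hi
    · have : (v i).toNat = (w i).toNat := by omega
      revert this
      cases v i <;> cases w i <;> simp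

theorem prefixValue_true (n : ℕ) : prefixValue (fun _ => true) n + 1 = 2 ^ n := by
  induction n with
  | zero => rfl
  | succ n ih => simp only [prefixValue, pow_succ, Bool.toNat_true]; omega

/-- The first `n` binary digits of `x ∈ [0,1)` spell out `⌊2ⁿ x⌋`. -/
theorem prefixValue_binExp {x : ℝ} (hx : x ∈ Ico (0 : ℝ) 1) (n : ℕ) :
    (prefixValue (binExp x) n : ℤ) = ⌊(2 : ℝ) ^ n * x⌋ := by
  induction n with
  | zero => simp [prefixValue, Int.floor_eq_zero_iff.mpr hx]
  | succ n ih =>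
    have h1 : 2 * ⌊(2 : ℝ) ^ n * x⌋ ≤ ⌊(2 : ℝ) ^ (n + 1) * x⌋ := by
      rw [Int.le_floor]
      push_cast
      have := Int.floor_le ((2 : ℝ) ^ n * x)
      rw [pow_succ]; linarith
    have h2 : ⌊(2 : ℝ) ^ (n + 1) * x⌋ < 2 * ⌊(2 : ℝ) ^ n * x⌋ + 2 := by
      rw [Int.floor_lt]
      push_cast
      have := Int.lt_floor_add_one ((2 : ℝ) ^ n * x)
      rw [pow_succ]; linarith
    simp only [prefixValue, Nat.cast_add, Nat.cast_mul, ih, binExp]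
    by_cases h : ⌊(2 : ℝ) ^ (n + 1) * x⌋ % 2 = 1
    · simp [h]; omega
    · simp [h]; omega

theorem binExp_injOn : InjOn binExp (Ico (0 : ℝ) 1) := by
  intro x hx y hy h
  by_contra hne
  obtain ⟨n, hn⟩ := exists_pow_lt_of_lt_one (abs_pos.mpr (sub_ne_zero.mpr hne))
    (by norm_num : (1 / 2 : ℝ) < 1)
  have hf : ⌊(2 : ℝ) ^ n * x⌋ = ⌊(2 : ℝ) ^ n * y⌋ := by
    rw [← prefixValue_binExp hx, ← prefixValue_binExp hy, h]
  have := Int.abs_sub_lt_one_of_floor_eq_floor hf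
  rw [← mul_sub, abs_mul, abs_of_pos (by positivity)] at this
  rw [one_div, inv_pow, inv_lt_iff_one_lt_mul₀' (by positivity)] at hn
  linarith

/-- Translating by an integer multiple of `2⁻ⁿ` does not affect the digits from `n` on. -/
theorem binExp_add_div_apply (x : ℝ) (c : ℤ) {n i : ℕ} (hi : n ≤ i) :
    binExp (x + c / 2 ^ n) i = binExp x i := by
  obtain ⟨k, rfl⟩ := Nat.exists_eq_add_of_le hi
  have h : (2 : ℝ) ^ (n + k + 1) * (x + c / 2 ^ n) =
      2 ^ (n + k + 1) * x + ((2 * (2 ^ k * c) : ℤ) : ℝ) := by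
    push_cast
    field_simp
    ring
  simp only [binExp, h, Int.floor_add_intCast]
  congr 2
  omega

theorem mem_Ico_of_floor_eq {x : ℝ} {n N : ℕ} (hN : N < 2 ^ n)
    (h : ⌊(2 : ℝ) ^ n * x⌋ = N) : x ∈ Ico (0 : ℝ) 1 := by
  rw [Int.floor_eq_iff] at h
  obtain ⟨h0, h1⟩ := h
  have hN' : (N : ℝ) + 1 ≤ 2 ^ n := by exact_mod_cast hN
  have hp : (0 : ℝ) < 2 ^ n := by positivity
  push_cast at h0 h1
  have hN0 : (0 : ℝ) ≤ N := N.cast_nonneg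
  constructor
  · by_contra! hneg; nlinarith
  · by_contra! hge; nlinarith

/-- A point whose `n`-th dyadic floor is the value of the prefix of `w`, and whose later digits
are those of `w`, has binary expansion `w`. -/
theorem binExp_eq_of_floor_eq {x : ℝ} {w : ℕ → Bool} {n : ℕ}
    (h : ⌊(2 : ℝ) ^ n * x⌋ = prefixValue w n) (htail : ∀ i, n ≤ i → binExp x i = w i) :
    binExp x = w := by
  have hx := mem_Ico_of_floor_eq (prefixValue_lt w n) h
  rw [← prefixValue_binExp hx] at h
  funext i
  rcases lt_or_ge i n with hi | hi
  · exact eq_of_prefixValue_eq (by exact_mod_cast h) i hi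
  · exact htail i hi

theorem exists_mem_Ico_one_sub {y : ℝ} (hy : y ∈ Ico (0 : ℝ) 1) :
    ∃ k : ℕ, ⌊(2 : ℝ) ^ k * y⌋ = 2 ^ k - 1 ∧ ⌊(2 : ℝ) ^ (k + 1) * y⌋ = 2 ^ (k + 1) - 2 := by
  obtain ⟨k, h1, h2⟩ := exists_nat_pow_near_of_lt_one (x := 1 - y) (y := (1 / 2 : ℝ))
    (by linarith [hy.2]) (by linarith [hy.1]) (by norm_num) (by norm_num)
  have hp : (0 : ℝ) < 2 ^ k := by positivity
  have e : (2 : ℝ) ^ k * (1 / 2) ^ k = 1 := by rw [← mul_pow]; norm_num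
  have h3 := mul_lt_mul_of_pos_left h1 hp
  have h4 := mul_le_mul_of_nonneg_left h2 hp.le
  rw [pow_succ (1 / 2 : ℝ), ← mul_assoc] at h3
  rw [e] at h3 h4
  refine ⟨k, ?_, ?_⟩ <;> rw [Int.floor_eq_iff] <;> push_cast <;>
    constructor <;> (try rw [pow_succ]) <;> linarith

/-- The binary digit map conjugates the von Neumann–Kakutani map to the adding machine. -/
theorem IsVNK.binExp_apply {A : ℝ → ℝ} (hA : IsVNK A) {y : ℝ} (hy : y ∈ Ico (0 : ℝ) 1) :
    binExp (A y) = addingMachine (binExp y) := by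
  obtain ⟨k, hk, hk'⟩ := exists_mem_Ico_one_sub hy
  have hones : ∀ i < k, binExp y i = true := by
    refine eq_of_prefixValue_eq (w := fun _ => true) ?_
    have h1 := prefixValue_binExp hy k
    have h2 := prefixValue_true k
    zify at h2 ⊢
    omega
  have hzero : binExp y k = false := by
    rw [binExp, hk', decide_eq_false_iff_not, pow_succ]
    omega
  have hp : (0 : ℝ) < 2 ^ k := by positivity
  have hAy : A y = y + ((3 - 2 ^ (k + 1) : ℤ) : ℝ) / 2 ^ (k + 1) := by
    have hz : (2 : ℝ) ^ (-((k + 1 : ℕ) : ℤ)) = (2 ^ (k + 1))⁻¹ := by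
      rw [zpow_neg, zpow_natCast]
    have hz' : (2 : ℝ) ^ (1 - ((k + 1 : ℕ) : ℤ)) = (2 ^ k)⁻¹ := by
      rw [← zpow_natCast, ← zpow_neg]; congr 1; push_cast; ring
    rw [hA (k + 1) (by omega) y, hz]
    · push_cast; field_simp; ring
    · rw [hz, hz', Int.floor_eq_iff] at *
      push_cast at hk hk'
      constructor
      · rw [sub_le_iff_le_add, ← mul_le_mul_iff_right₀ hp, mul_add, mul_inv_cancel₀ hp.ne']
        linarith [hk.1]
      · have hp' : (0 : ℝ) < 2 ^ (k + 1) := by positivity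
        rw [lt_sub_iff_add_lt, ← mul_lt_mul_iff_right₀ hp', mul_add, mul_inv_cancel₀ hp'.ne']
        linarith [hk'.2]
  apply binExp_eq_of_floor_eq (n := k + 1)
  · have hval : prefixValue (addingMachine (binExp y)) (k + 1) = 1 := by
      have h0 : prefixValue (addingMachine (binExp y)) k = 0 := by
        have hfalse : ∀ n, prefixValue (fun _ => false) n = 0 := by
          intro n; induction n with
          | zero => rfl
          | succ n ih => simp [prefixValue, ih]
        rw [← hfalse k]
        refine prefixValue_congr fun i hi => ?_
        rw [addingMachine, if_pos fun j hj => hones j (hj.trans hi), hones i hi]; rfl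
      rw [prefixValue, h0, addingMachine, if_pos hones, hzero]; rfl
    have hmul : (2 : ℝ) ^ (k + 1) * A y = 2 ^ (k + 1) * y + ((3 - 2 ^ (k + 1) : ℤ) : ℝ) := by
      rw [hAy]; field_simp
    rw [hmul, Int.floor_add_intCast, hk', hval]
    push_cast
    ring
  · intro i hi
    rw [hAy, binExp_add_div_apply _ _ hi, addingMachine, if_neg]
    intro h
    simpa [hzero] using h k (by omega)

theorem floor_eq_of_mem_Ico_div {x : ℝ} {n N : ℕ}
    (hx : x ∈ Ico ((N : ℝ) / 2 ^ n) ((N + 1) / 2 ^ n)) : ⌊(2 : ℝ) ^ n * x⌋ = N := by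
  rw [Int.floor_eq_iff]
  have hp : (0 : ℝ) < 2 ^ n := by positivity
  rw [mem_Ico, div_le_iff₀' hp, lt_div_iff₀' hp] at hx
  exact_mod_cast hx

theorem mem_Ico_div_of_floor_eq {x : ℝ} {n N : ℕ}
    (h : ⌊(2 : ℝ) ^ n * x⌋ = N) : x ∈ Ico ((N : ℝ) / 2 ^ n) ((N + 1) / 2 ^ n) := by
  rw [Int.floor_eq_iff] at h
  have hp : (0 : ℝ) < 2 ^ n := by positivity
  rw [mem_Ico, div_le_iff₀' hp, lt_div_iff₀' hp]
  exact_mod_cast h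

theorem floor_two_pow_mul_div (n N : ℕ) : ⌊(2 : ℝ) ^ n * ((N : ℝ) / 2 ^ n)⌋ = N := by
  rw [mul_div_cancel₀ _ (by positivity)]
  simp

theorem binExp_natCast_div_apply (N : ℕ) {n i : ℕ} (hi : n ≤ i) :
    binExp ((N : ℝ) / 2 ^ n) i = false := by
  have := binExp_add_div_apply 0 N hi
  rw [zero_add, Int.cast_natCast] at this
  rw [this]
  simp [binExp]

/-- The map induced by `g` on prefixes of length `m`, encoded as integers below `2 ^ m`. -/
def prefixMap (g : (ℕ → Bool) → (ℕ → Bool)) (m : ℕ) (p : Fin (2 ^ m)) : Fin (2 ^ m) :=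
  ⟨prefixValue (g (binExp (((p : ℕ) : ℝ) / 2 ^ m))) m, prefixValue_lt _ _⟩

theorem prefixMap_injective {g : (ℕ → Bool) → (ℕ → Bool)} (hg : Injective g) {m : ℕ}
    (hfin : ∀ (w : ℕ → Bool) (i : ℕ), m ≤ i → g w i = w i) : Injective (prefixMap g m) := by
  intro p q h
  have h := eq_of_prefixValue_eq (Fin.mk.inj h)
  have hgpq : g (binExp (((p : ℕ) : ℝ) / 2 ^ m)) = g (binExp (((q : ℕ) : ℝ) / 2 ^ m)) := by
    funext i
    rcases lt_or_ge i m with hi | hi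
    · exact h i hi
    · rw [hfin _ i hi, hfin _ i hi, binExp_natCast_div_apply _ hi, binExp_natCast_div_apply _ hi]
  have hp := floor_two_pow_mul_div m p
  have hq := floor_two_pow_mul_div m q
  rw [← prefixValue_binExp (mem_Ico_of_floor_eq p.2 hp)] at hp
  rw [← prefixValue_binExp (mem_Ico_of_floor_eq q.2 hq), ← hg hgpq, hp] at hq
  exact Fin.ext (by exact_mod_cast hq)

/-- The interval exchange given by `prefixMap g m` corresponds to `g` under the digit map. -/
theorem IsIET.binExp_apply {g : (ℕ → Bool) → (ℕ → Bool)} (hg : PrefixPreserving g) {m : ℕ}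
    (hfin : ∀ (w : ℕ → Bool) (i : ℕ), m ≤ i → g w i = w i) {π : Equiv.Perm (Fin (2 ^ m))}
    (hπ : ∀ p, π p = prefixMap g m p) {R : ℝ → ℝ} (hR : IsIET (2 ^ m) π R) {x : ℝ}
    (hx : x ∈ Ico (0 : ℝ) 1) :
    R x ∈ Ico (0 : ℝ) 1 ∧ binExp (R x) = g (binExp x) := by
  let p : Fin (2 ^ m) := ⟨prefixValue (binExp x) m, prefixValue_lt _ _⟩
  have hp : ⌊(2 : ℝ) ^ m * x⌋ = (p : ℕ) := (prefixValue_binExp hx m).symm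
  have hRx : R x = x + (((π p : ℕ) - (p : ℕ) : ℤ) : ℝ) / 2 ^ m := by
    have := hR p x (by simpa using mem_Ico_div_of_floor_eq hp)
    rw [this]
    push_cast
    rfl
  have hdigits : ∀ i < m, binExp (((p : ℕ) : ℝ) / 2 ^ m) i = binExp x i := by
    refine eq_of_prefixValue_eq ?_
    have h := floor_two_pow_mul_div m p
    rw [← prefixValue_binExp (mem_Ico_of_floor_eq p.2 h)] at h
    exact_mod_cast h
  have hfloor : ⌊(2 : ℝ) ^ m * R x⌋ = prefixValue (g (binExp x)) m := by
    have hmul : (2 : ℝ) ^ m * R x = 2 ^ m * x + (((π p : ℕ) - (p : ℕ) : ℤ) : ℝ) := by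
      rw [hRx]; field_simp
    rw [hmul, Int.floor_add_intCast, hp, ← prefixValue_congr (hg m _ _ hdigits), hπ]
    simp [prefixMap]
  refine ⟨mem_Ico_of_floor_eq (prefixValue_lt _ _) hfloor,
    binExp_eq_of_floor_eq hfloor fun i hi => ?_⟩
  rw [hRx, binExp_add_div_apply _ _ hi, hfin _ i hi]

theorem measurable_binExp : Measurable binExp := by
  refine measurable_pi_lambda _ fun i => ?_
  have h : Measurable fun x : ℝ => ⌊(2 : ℝ) ^ (i + 1) * x⌋ :=
    Int.measurable_floor.comp (measurable_const_mul _)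
  exact (measurable_from_top (f := fun k : ℤ => decide (k % 2 = 1))).comp h

/-- The cylinder sets of `{0,1}^ℕ`. -/
def cylinderSets : Set (Set (ℕ → Bool)) :=
  {s | ∃ (n : ℕ) (u : Fin n → Bool), s = {w | ∀ i : Fin n, w (i : ℕ) = u i}}

theorem isPiSystem_cylinderSets : IsPiSystem cylinderSets := by
  rintro _ ⟨n, u, rfl⟩ _ ⟨k, v, rfl⟩ ⟨z, hzu, hzv⟩
  refine ⟨max n k, fun i => z i, ?_⟩
  ext w
  simp only [mem_inter_iff, mem_ofPred_eq] at *
  constructor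
  · rintro ⟨h1, h2⟩ ⟨i, hi⟩
    rcases lt_max_iff.mp hi with h | h
    · exact (h1 ⟨i, h⟩).trans (hzu ⟨i, h⟩).symm
    · exact (h2 ⟨i, h⟩).trans (hzv ⟨i, h⟩).symm
  · intro h
    exact ⟨fun i => (h ⟨i, lt_max_of_lt_left i.2⟩).trans (hzu i),
      fun i => (h ⟨i, lt_max_of_lt_right i.2⟩).trans (hzv i)⟩

theorem measurableSet_cylinder (n : ℕ) (u : Fin n → Bool) :
    MeasurableSet {w : ℕ → Bool | ∀ i : Fin n, w (i : ℕ) = u i} := by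
  simp only [ofPred_forall]
  exact MeasurableSet.iInter fun i =>
    measurable_pi_apply (X := fun _ : ℕ => Bool) (i : ℕ) (measurableSet_singleton (u i))

theorem generateFrom_cylinderSets :
    (MeasurableSpace.pi : MeasurableSpace (ℕ → Bool)) =
      MeasurableSpace.generateFrom cylinderSets := by
  apply le_antisymm
  · refine iSup_le fun i => ?_
    rintro _ ⟨t, -, rfl⟩
    have h : (fun w : ℕ → Bool => w i) ⁻¹' t =
        ⋃ u ∈ {u : Fin (i + 1) → Bool | u (Fin.last i) ∈ t},
          {w | ∀ j : Fin (i + 1), w (j : ℕ) = u j} := by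
      ext w
      simp only [mem_preimage, mem_iUnion, mem_ofPred_eq, exists_prop]
      constructor
      · exact fun hw => ⟨fun j => w j, hw, fun _ => rfl⟩
      · rintro ⟨u, hu, hw⟩
        rwa [← hw] at hu
    rw [h]
    exact MeasurableSet.biUnion (to_countable _) fun u _ =>
      MeasurableSpace.measurableSet_generateFrom ⟨_, u, rfl⟩
  · refine MeasurableSpace.generateFrom_le ?_
    rintro _ ⟨n, u, rfl⟩
    exact measurableSet_cylinder n u

theorem IsBernoulli.ext {μ ν : Measure (ℕ → Bool)} (hμ : IsBernoulli μ) (hν : IsBernoulli ν) :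
    μ = ν := by
  have huniv : ∀ {ρ : Measure (ℕ → Bool)}, IsBernoulli ρ → ρ univ = 1 := by
    intro ρ hρ
    simpa using hρ 0 Fin.elim0
  have : IsFiniteMeasure μ := ⟨by simp [huniv hμ]⟩
  refine ext_of_generate_finite cylinderSets generateFrom_cylinderSets isPiSystem_cylinderSets
    ?_ ((huniv hμ).trans (huniv hν).symm)
  rintro _ ⟨n, u, rfl⟩
  rw [hμ, hν]

theorem isBernoulli_map_binExp :
    IsBernoulli (Measure.map binExp (volume.restrict (Ico (0 : ℝ) 1))) := by
  intro n u
  rw [Measure.map_apply measurable_binExp (measurableSet_cylinder n u),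
    Measure.restrict_apply (measurable_binExp (measurableSet_cylinder n u))]
  let v : ℕ → Bool := fun i => if h : i < n then u ⟨i, h⟩ else false
  have h : binExp ⁻¹' {w | ∀ i : Fin n, w (i : ℕ) = u i} ∩ Ico (0 : ℝ) 1 =
      Ico ((prefixValue v n : ℝ) / 2 ^ n) ((prefixValue v n + 1) / 2 ^ n) := by
    ext x
    simp only [mem_inter_iff, mem_preimage, mem_ofPred_eq]
    constructor
    · rintro ⟨hx, hx01⟩
      apply mem_Ico_div_of_floor_eq
      rw [← prefixValue_binExp hx01]
      congr 1
      exact prefixValue_congr fun i hi => by simpa [v, hi] using hx ⟨i, hi⟩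
    · intro hx
      have hf := floor_eq_of_mem_Ico_div hx
      have hx01 := mem_Ico_of_floor_eq (prefixValue_lt v n) hf
      refine ⟨fun i => ?_, hx01⟩
      rw [← prefixValue_binExp hx01] at hf
      have := eq_of_prefixValue_eq (Nat.cast_injective hf) i i.2
      rwa [show v i = u i from dif_pos i.2] at this
  rw [h, Real.volume_Ico, ← sub_div, add_sub_cancel_left, one_div,
    ENNReal.ofReal_inv_of_pos (by positivity), ENNReal.ofReal_pow (by norm_num), ENNReal.inv_pow]
  simp

/-- if `g` is a prefix-preserving homeomorphism of `{0,1}^ℕ` which changes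
only the first `m` coordinates (paper: `g(w)_i = w_i` for `i > m`), then there is a
permutation `π` of `{0,…,2^m-1}` such that the binary digit map `φ` intertwines the
rotated odometer `F_π = ā ∘ R_π` (with `q = 2^m`) with `a ∘ g`; moreover `φ` is
injective and pushes Lebesgue measure forward to the Bernoulli measure `μ₁`. -/
theorem stmt6 (g : (ℕ → Bool) ≃ₜ (ℕ → Bool)) (hg : PrefixPreserving ⇑g)
    (m : ℕ) (hm : 1 ≤ m) (hfin : ∀ (w : ℕ → Bool) (i : ℕ), m ≤ i → g w i = w i)
    (μ : Measure (ℕ → Bool)) (hμ : IsBernoulli μ) :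
    ∃ π : Equiv.Perm (Fin (2^m)),
      ∀ A R : ℝ → ℝ, IsVNK A → IsIET (2^m) π R →
        (∀ x ∈ Set.Ico (0:ℝ) 1, binExp (A (R x)) = addingMachine (g (binExp x))) ∧
        Set.InjOn binExp (Set.Ico (0:ℝ) 1) ∧
        Measure.map binExp (volume.restrict (Set.Ico (0:ℝ) 1)) = μ := by
  let π : Equiv.Perm (Fin (2 ^ m)) :=
    Equiv.ofBijective _ (Finite.injective_iff_bijective.mp (prefixMap_injective g.injective hfin))
  refine ⟨π, fun A R hA hR => ⟨fun x hx => ?_, binExp_injOn, isBernoulli_map_binExp.ext hμ⟩⟩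
  obtain ⟨hRmem, hRx⟩ := hR.binExp_apply hg hfin (fun _ => rfl) hx
  rw [← hRx]
  exact hA.binExp_apply hRmem
end
end
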